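/- (Theorem 5.9, ITE risk bound via Pair loss) Assume: r_0 is K_0-Lipschitz and r_1 is K_1-Lipschitz; for every x and every t ∈ {0,1}, the expected neighbor distance satisfies ∫ ‖x − x'‖ q_t(x'|x) dx' ≤ δ; there is B > 0 such that (1/B)·r_0² ∈ G and (1/B)·r_1² ∈ G; and all integrals appearing in the definitions below are finite with Fubini's theorem applicable. Then ε_ITE ≤ ε_pair + Σ_{t∈{0,1}} u_t · [ B · IPM_G(p_t, q_t) + 2·K_{1−t}·δ·√(ε_F^t) ]. -/

import Mathlib

open MeasureTheory

noncomputable section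

/-- Covariate space: `ℝ^d` with the Euclidean norm and Lebesgue measure. -/
abbrev Euc (d : ℕ) := EuclideanSpace ℝ (Fin d)

/-- Integral probability metric for a family `G` of functions:
`IPM_G(p,q) = sup_{g ∈ G} |∫ g(x)(p(x) − q(x)) dx|`. -/
def IPM {d : ℕ} (G : Set (Euc d → ℝ)) (p q : Euc d → ℝ) : ℝ :=
  sSup ((fun g => |∫ x, g x * (p x - q x)|) '' G)

/-- Cauchy–Schwarz for a function against a probability density. -/
theorem integral_abs_mul_density_le_sqrt {α : Type*} [MeasurableSpace α] {μ : Measure α}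
    {p r : α → ℝ} (hpm : Measurable p) (hp0 : ∀ x, 0 ≤ p x) (hp1 : (∫ x, p x ∂μ) = 1)
    (hrm : Measurable r) (hr : Integrable (fun x => r x ^ 2 * p x) μ) :
    Integrable (fun x => |r x| * p x) μ ∧
      (∫ x, |r x| * p x ∂μ) ≤ Real.sqrt (∫ x, r x ^ 2 * p x ∂μ) := by
  have hp : Integrable p μ := integrable_of_integral_eq_one hp1
  have habs : Integrable (fun x => |r x| * p x) μ := by
    refine (hp.add hr).mono' (by fun_prop) (.of_forall fun x => ?_)
    rw [Real.norm_of_nonneg (mul_nonneg (abs_nonneg _) (hp0 x)), Pi.add_apply, ← sq_abs]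
    nlinarith [hp0 x, mul_nonneg (hp0 x) (sq_nonneg (|r x| - 1)),
      mul_nonneg (hp0 x) (sq_nonneg (|r x|))]
  refine ⟨habs, Real.le_sqrt_of_sq_le ?_⟩
  set m := ∫ x, |r x| * p x ∂μ with hm
  have hvar : 0 ≤ ∫ x, (r x ^ 2 * p x - 2 * m * (|r x| * p x)) + m ^ 2 * p x ∂μ := by
    refine integral_nonneg fun x => ?_
    have := mul_nonneg (hp0 x) (sq_nonneg (|r x| - m))
    simp only [Pi.zero_apply]
    rw [← sq_abs (r x)]
    linarith
  rw [integral_add (hr.sub' (habs.const_mul _)) (hp.const_mul _),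
    integral_sub hr (habs.const_mul _), integral_const_mul, integral_const_mul, hp1, ← hm] at hvar
  linarith

/-- The difference of two means of a scaled member of `G` is controlled by the IPM. -/
theorem integral_sub_integral_le_mul_IPM {d : ℕ} {G : Set (Euc d → ℝ)} {p q f : Euc d → ℝ}
    {B : ℝ} (hB : 0 < B) (hG : (fun x => (1 / B) * f x) ∈ G)
    (hfp : Integrable (fun x => f x * p x)) (hfq : Integrable (fun x => f x * q x))
    (hbdd : BddAbove ((fun g => |∫ x, g x * (p x - q x)|) '' G)) :
    (∫ x, f x * p x) - (∫ x, f x * q x) ≤ B * IPM G p q := by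
  have hle : |∫ x, (1 / B) * f x * (p x - q x)| ≤ IPM G p q :=
    le_csSup hbdd ⟨_, hG, rfl⟩
  have heq : (∫ x, (1 / B) * f x * (p x - q x)) =
      (1 / B) * ((∫ x, f x * p x) - (∫ x, f x * q x)) := by
    rw [← integral_sub hfp hfq, ← integral_const_mul]
    exact integral_congr_ae (.of_forall fun x => by ring)
  rw [heq] at hle
  have hmul := mul_le_mul_of_nonneg_left ((le_abs_self _).trans hle) hB.le
  rwa [← mul_assoc, mul_one_div_cancel hB.ne', one_mul] at hmul

/-- The bias of a Lipschitz function averaged over neighbors is at most `K * δ`. -/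
theorem abs_integral_neighbor_sub_le {d : ℕ} {s k : Euc d → ℝ} {K δ : ℝ} {x : Euc d}
    (hk0 : ∀ x', 0 ≤ k x') (hK : 0 ≤ K) (hLip : ∀ x y, |s x - s y| ≤ K * ‖x - y‖)
    (hdist : Integrable (fun x' => ‖x - x'‖ * k x'))
    (hnbr : (∫ x', ‖x - x'‖ * k x') ≤ δ) :
    |∫ x', (s x' - s x) * k x'| ≤ K * δ := by
  rw [← Real.norm_eq_abs]
  refine (norm_integral_le_of_norm_le (hdist.const_mul K) (.of_forall fun x' => ?_)).trans ?_
  · rw [norm_mul, Real.norm_of_nonneg (hk0 x'), Real.norm_eq_abs, ← mul_assoc, norm_sub_rev]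
    exact mul_le_mul_of_nonneg_right (hLip x' x) (hk0 x')
  · rw [integral_const_mul]
    exact mul_le_mul_of_nonneg_left hnbr hK

/-- Integrating `f x * q(x'|x)` over pairs integrates out the neighbor. -/
theorem integral_prod_mul_conditional {d : ℕ} {f : Euc d → ℝ} {q : Euc d → Euc d → ℝ}
    (hq1 : ∀ x, (∫ x', q x x') = 1)
    (h : Integrable (fun z : Euc d × Euc d => f z.1 * q z.1 z.2)) :
    (∫ z : Euc d × Euc d, f z.1 * q z.1 z.2) = ∫ x, f x := by
  rw [Measure.volume_eq_prod] at h ⊢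
  rw [integral_prod _ h]
  simp only [integral_const_mul, hq1, mul_one]

/-- Expansion of the pair loss of one treatment arm. -/
theorem pair_loss_expansion {d : ℕ} {p r s : Euc d → ℝ} {q : Euc d → Euc d → ℝ}
    (hq1 : ∀ x, (∫ x', q x x') = 1)
    (hpair : Integrable (fun z : Euc d × Euc d => (r z.1 - s z.2) ^ 2 * q z.1 z.2 * p z.1))
    (hcross : Integrable (fun z : Euc d × Euc d => s z.2 * r z.1 * q z.1 z.2 * p z.1))
    (hmarg : Integrable (fun z : Euc d × Euc d => s z.2 ^ 2 * q z.1 z.2 * p z.1))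
    (hrs : Integrable (fun x => r x * s x * p x))
    (hg : Integrable (fun x => r x * (∫ x', (s x' - s x) * q x x') * p x))
    (hgint : ∀ x, Integrable (fun x' => (s x' - s x) * q x x')) :
    (∫ x, ∫ x', (r x - s x') ^ 2 * q x x' * p x) =
      (∫ x, r x ^ 2 * p x)
        - 2 * ((∫ x, r x * (∫ x', (s x' - s x) * q x x') * p x) + ∫ x, r x * s x * p x)
        + ∫ x, s x ^ 2 * (∫ y, q y x * p y) := by
  have hfact : Integrable (fun z : Euc d × Euc d => (r z.1 ^ 2 * p z.1) * q z.1 z.2) :=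
    ((hpair.add (hcross.const_mul 2)).sub hmarg).congr
      (.of_forall fun z => by simp only [Pi.add_apply, Pi.sub_apply]; ring)
  have hmarg_eq : (∫ z : Euc d × Euc d, s z.2 ^ 2 * q z.1 z.2 * p z.1) =
      ∫ x, s x ^ 2 * (∫ y, q y x * p y) := by
    rw [Measure.volume_eq_prod] at hmarg ⊢
    rw [integral_prod_symm _ hmarg]
    simp only [mul_assoc, integral_const_mul]
  have hcross_eq : (∫ z : Euc d × Euc d, s z.2 * r z.1 * q z.1 z.2 * p z.1) =
      (∫ x, r x * (∫ x', (s x' - s x) * q x x') * p x) + ∫ x, r x * s x * p x := by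
    rw [Measure.volume_eq_prod] at hcross ⊢
    rw [integral_prod _ hcross, ← integral_add hg hrs]
    refine integral_congr_ae (.of_forall fun x => ?_)
    have hq : Integrable (q x) := integrable_of_integral_eq_one (hq1 x)
    have hsplit : (fun x' => s x' * r x * q x x' * p x) =
        fun x' => (r x * p x) * ((s x' - s x) * q x x' + s x * q x x') := by
      funext x'
      ring
    simp only [hsplit]
    rw [integral_const_mul, integral_add (hgint x) (hq.const_mul _), integral_const_mul, hq1]
    ring
  have hpair_eq : (∫ x, ∫ x', (r x - s x') ^ 2 * q x x' * p x) =
      ∫ z : Euc d × Euc d, (r z.1 - s z.2) ^ 2 * q z.1 z.2 * p z.1 := by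
    rw [Measure.volume_eq_prod] at hpair ⊢
    exact (integral_prod _ hpair).symm
  have hexpand : (fun z : Euc d × Euc d => (r z.1 - s z.2) ^ 2 * q z.1 z.2 * p z.1) =
      fun z => ((r z.1 ^ 2 * p z.1) * q z.1 z.2 - 2 * (s z.2 * r z.1 * q z.1 z.2 * p z.1))
        + s z.2 ^ 2 * q z.1 z.2 * p z.1 := by
    funext z
    ring
  rw [hpair_eq, hexpand, integral_add (hfact.sub' (hcross.const_mul 2)) hmarg,
    integral_sub hfact (hcross.const_mul 2), integral_const_mul, hcross_eq, hmarg_eq,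
    integral_prod_mul_conditional (f := fun x => r x ^ 2 * p x) hq1 hfact]

/-- The ITE risk bound restricted to one treatment arm with density `p`, factual residual `r`
and counterfactual residual `s`. -/
theorem arm_risk_le {d : ℕ} {p r s : Euc d → ℝ} {q : Euc d → Euc d → ℝ}
    {K δ B : ℝ} {G : Set (Euc d → ℝ)}
    (hpm : Measurable p) (hp0 : ∀ x, 0 ≤ p x) (hp1 : (∫ x, p x) = 1)
    (hrm : Measurable r) (hsm : Measurable s)
    (hq0 : ∀ x x', 0 ≤ q x x') (hq1 : ∀ x, (∫ x', q x x') = 1)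
    (hK : 0 ≤ K) (hLip : ∀ x y, |s x - s y| ≤ K * ‖x - y‖)
    (hδ : 0 ≤ δ) (hnbr : ∀ x, (∫ x', ‖x - x'‖ * q x x') ≤ δ)
    (hB : 0 < B) (hG : (fun x => (1 / B) * s x ^ 2) ∈ G)
    (hpair : Integrable (fun z : Euc d × Euc d => (r z.1 - s z.2) ^ 2 * q z.1 z.2 * p z.1))
    (hcross : Integrable (fun z : Euc d × Euc d => s z.2 * r z.1 * q z.1 z.2 * p z.1))
    (hmarg : Integrable (fun z : Euc d × Euc d => s z.2 ^ 2 * q z.1 z.2 * p z.1))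
    (hr : Integrable (fun x => r x ^ 2 * p x)) (hs : Integrable (fun x => s x ^ 2 * p x))
    (hsQ : Integrable (fun x => s x ^ 2 * (∫ y, q y x * p y)))
    (hg : Integrable (fun x => r x * (∫ x', (s x' - s x) * q x x') * p x))
    (hgint : ∀ x, Integrable (fun x' => (s x' - s x) * q x x'))
    (hdist : ∀ x, Integrable (fun x' => ‖x - x'‖ * q x x'))
    (hbdd : BddAbove ((fun g => |∫ x, g x * (p x - ∫ y, q y x * p y)|) '' G)) :
    Integrable (fun x => (r x - s x) ^ 2 * p x) ∧
    (∫ x, (r x - s x) ^ 2 * p x) ≤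
      (∫ x, ∫ x', (r x - s x') ^ 2 * q x x' * p x) +
        (B * IPM G p (fun x => ∫ y, q y x * p y) +
          2 * K * δ * Real.sqrt (∫ x, r x ^ 2 * p x)) := by
  have hrs : Integrable (fun x => r x * s x * p x) := by
    refine (hr.add hs).mono' (by fun_prop) (.of_forall fun x => ?_)
    rw [norm_mul, Real.norm_of_nonneg (hp0 x), Pi.add_apply, ← add_mul, Real.norm_eq_abs]
    refine mul_le_mul_of_nonneg_right (abs_le.2 ⟨?_, ?_⟩) (hp0 x) <;>
      nlinarith [sq_nonneg (r x + s x), sq_nonneg (r x - s x), sq_nonneg (r x), sq_nonneg (s x)]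
  have hexpand : (fun x => (r x - s x) ^ 2 * p x) =
      fun x => (r x ^ 2 * p x - 2 * (r x * s x * p x)) + s x ^ 2 * p x := by
    funext x
    ring
  rw [hexpand]
  refine ⟨(hr.sub (hrs.const_mul 2)).add hs, ?_⟩
  rw [integral_add (hr.sub' (hrs.const_mul 2)) hs, integral_sub hr (hrs.const_mul 2),
    integral_const_mul, pair_loss_expansion hq1 hpair hcross hmarg hrs hg hgint]
  obtain ⟨habs, hsqrt⟩ := integral_abs_mul_density_le_sqrt hpm hp0 hp1 hrm hr
  have hbias : (∫ x, r x * (∫ x', (s x' - s x) * q x x') * p x) ≤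
      K * δ * Real.sqrt (∫ x, r x ^ 2 * p x) := by
    refine (integral_mono hg (habs.const_mul (K * δ)) fun x => ?_).trans ?_
    · have hgx := abs_integral_neighbor_sub_le (hq0 x) hK hLip (hdist x) (hnbr x)
      have hmul := mul_le_mul_of_nonneg_left hgx (abs_nonneg (r x))
      rw [← abs_mul] at hmul
      have := mul_le_mul_of_nonneg_right ((le_abs_self _).trans hmul) (hp0 x)
      dsimp only
      linarith
    · rw [integral_const_mul]
      exact mul_le_mul_of_nonneg_left hsqrt (mul_nonneg hK hδ)
  have hipm := integral_sub_integral_le_mul_IPM (f := fun x => s x ^ 2) hB hG hs hsQ hbdd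
  linarith

/-- **Theorem 5.9 (ITE risk bound via Pair loss).**
`ε_ITE ≤ ε_pair + Σ_{t∈{0,1}} u_t [ B · IPM_G(p_t, q_t) + 2 K_{1−t} δ √(ε_F^t) ]`,
where `q_t(x') = ∫ q_t(x'|x) p_t(x) dx` is the neighbor marginal and
`q₀ x x'` denotes the conditional density `q₀(x'|x)`. -/
theorem ite_risk_bound_pair_loss {d : ℕ}
    (p₀ p₁ r₀ r₁ : Euc d → ℝ) (q₀ q₁ : Euc d → Euc d → ℝ)
    (u₀ u₁ K₀ K₁ δ B : ℝ) (G : Set (Euc d → ℝ))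
    -- densities
    (hp₀m : Measurable p₀) (hp₁m : Measurable p₁)
    (hp₀0 : ∀ x, 0 ≤ p₀ x) (hp₁0 : ∀ x, 0 ≤ p₁ x)
    (hp₀1 : (∫ x, p₀ x) = 1) (hp₁1 : (∫ x, p₁ x) = 1)
    -- treatment marginals
    (hu₀ : 0 ≤ u₀) (hu₁ : 0 ≤ u₁) (hu : u₀ + u₁ = 1)
    -- residuals
    (hr₀m : Measurable r₀) (hr₁m : Measurable r₁)
    -- neighborhood conditional densities
    (hq₀m : Measurable (fun z : Euc d × Euc d => q₀ z.1 z.2))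
    (hq₁m : Measurable (fun z : Euc d × Euc d => q₁ z.1 z.2))
    (hq₀0 : ∀ x x', 0 ≤ q₀ x x') (hq₁0 : ∀ x x', 0 ≤ q₁ x x')
    (hq₀1 : ∀ x, (∫ x', q₀ x x') = 1) (hq₁1 : ∀ x, (∫ x', q₁ x x') = 1)
    -- `r₀` is `K₀`-Lipschitz and `r₁` is `K₁`-Lipschitz
    (hK₀ : 0 ≤ K₀) (hK₁ : 0 ≤ K₁)
    (hLip₀ : ∀ x y, |r₀ x - r₀ y| ≤ K₀ * ‖x - y‖)
    (hLip₁ : ∀ x y, |r₁ x - r₁ y| ≤ K₁ * ‖x - y‖)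
    -- expected neighbor distance bounded by `δ`
    (hδ : 0 ≤ δ)
    (hnbr₀ : ∀ x, (∫ x', ‖x - x'‖ * q₀ x x') ≤ δ)
    (hnbr₁ : ∀ x, (∫ x', ‖x - x'‖ * q₁ x x') ≤ δ)
    -- `(1/B)·r_t² ∈ G`
    (hB : 0 < B)
    (hG₀ : (fun x => (1 / B) * r₀ x ^ 2) ∈ G)
    (hG₁ : (fun x => (1 / B) * r₁ x ^ 2) ∈ G)
    -- all integrals appearing in the definitions are finite and Fubini applies
    (hITE : Integrable (fun x => (r₁ x - r₀ x) ^ 2 * (u₀ * p₀ x + u₁ * p₁ x)))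
    (hpair₀ : Integrable (fun z : Euc d × Euc d =>
      (r₀ z.1 - r₁ z.2) ^ 2 * q₀ z.1 z.2 * p₀ z.1))
    (hpair₁ : Integrable (fun z : Euc d × Euc d =>
      (r₁ z.1 - r₀ z.2) ^ 2 * q₁ z.1 z.2 * p₁ z.1))
    (hcross₀ : Integrable (fun z : Euc d × Euc d =>
      r₁ z.2 * r₀ z.1 * q₀ z.1 z.2 * p₀ z.1))
    (hcross₁ : Integrable (fun z : Euc d × Euc d =>
      r₁ z.1 * r₀ z.2 * q₁ z.1 z.2 * p₁ z.1))
    (hmarg₀ : Integrable (fun z : Euc d × Euc d =>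
      r₁ z.2 ^ 2 * q₀ z.1 z.2 * p₀ z.1))
    (hmarg₁ : Integrable (fun z : Euc d × Euc d =>
      r₀ z.2 ^ 2 * q₁ z.1 z.2 * p₁ z.1))
    (hr₀p₀ : Integrable (fun x => r₀ x ^ 2 * p₀ x))
    (hr₁p₁ : Integrable (fun x => r₁ x ^ 2 * p₁ x))
    (hr₁p₀ : Integrable (fun x => r₁ x ^ 2 * p₀ x))
    (hr₀p₁ : Integrable (fun x => r₀ x ^ 2 * p₁ x))
    (hr₁Q₀ : Integrable (fun x => r₁ x ^ 2 * (∫ y, q₀ y x * p₀ y)))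
    (hr₀Q₁ : Integrable (fun x => r₀ x ^ 2 * (∫ y, q₁ y x * p₁ y)))
    (hg₀₁ : Integrable (fun x => r₁ x * (∫ x', (r₀ x' - r₀ x) * q₁ x x') * p₁ x))
    (hg₁₀ : Integrable (fun x => r₀ x * (∫ x', (r₁ x' - r₁ x) * q₀ x x') * p₀ x))
    (hgint₀ : ∀ x, Integrable (fun x' => (r₁ x' - r₁ x) * q₀ x x'))
    (hgint₁ : ∀ x, Integrable (fun x' => (r₀ x' - r₀ x) * q₁ x x'))
    (hdist₀ : ∀ x, Integrable (fun x' => ‖x - x'‖ * q₀ x x'))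
    (hdist₁ : ∀ x, Integrable (fun x' => ‖x - x'‖ * q₁ x x'))
    -- the IPM suprema are finite
    (hbdd₀ : BddAbove
      ((fun g => |∫ x, g x * (p₀ x - ∫ y, q₀ y x * p₀ y)|) '' G))
    (hbdd₁ : BddAbove
      ((fun g => |∫ x, g x * (p₁ x - ∫ y, q₁ y x * p₁ y)|) '' G)) :
    (∫ x, (r₁ x - r₀ x) ^ 2 * (u₀ * p₀ x + u₁ * p₁ x)) ≤
      (u₀ * (∫ x, ∫ x', (r₀ x - r₁ x') ^ 2 * q₀ x x' * p₀ x) +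
       u₁ * (∫ x, ∫ x', (r₁ x - r₀ x') ^ 2 * q₁ x x' * p₁ x)) +
      (u₀ * (B * IPM G p₀ (fun x => ∫ y, q₀ y x * p₀ y) +
              2 * K₁ * δ * Real.sqrt (∫ x, r₀ x ^ 2 * p₀ x)) +
       u₁ * (B * IPM G p₁ (fun x => ∫ y, q₁ y x * p₁ y) +
              2 * K₀ * δ * Real.sqrt (∫ x, r₁ x ^ 2 * p₁ x))) := by
  obtain ⟨hI₀, h₀⟩ := arm_risk_le hp₀m hp₀0 hp₀1 hr₀m hr₁m hq₀0 hq₀1 hK₁ hLip₁ hδ hnbr₀ hB hG₁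
    hpair₀ hcross₀ hmarg₀ hr₀p₀ hr₁p₀ hr₁Q₀ hg₁₀ hgint₀ hdist₀ hbdd₀
  obtain ⟨hI₁, h₁⟩ := arm_risk_le hp₁m hp₁0 hp₁1 hr₁m hr₀m hq₁0 hq₁1 hK₀ hLip₀ hδ hnbr₁ hB hG₀
    hpair₁ (hcross₁.congr (.of_forall fun z => by ring)) hmarg₁ hr₁p₁ hr₀p₁ hr₀Q₁ hg₀₁ hgint₁
    hdist₁ hbdd₁
  have hsplit : (fun x => (r₁ x - r₀ x) ^ 2 * (u₀ * p₀ x + u₁ * p₁ x)) =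
      fun x => u₀ * ((r₀ x - r₁ x) ^ 2 * p₀ x) + u₁ * ((r₁ x - r₀ x) ^ 2 * p₁ x) := by
    funext x
    ring
  rw [hsplit, integral_add (hI₀.const_mul _) (hI₁.const_mul _), integral_const_mul,
    integral_const_mul]
  linarith [mul_le_mul_of_nonneg_left h₀ hu₀, mul_le_mul_of_nonneg_left h₁ hu₁]

end
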